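/- arXiv:2412.20246 — 6 statements merged into one kernel-verified Lean document; each statement's English description precedes it below -/
import Mathlib

section
/- Let G be a finite commutative group acting ℂ-linearly on a complex vector space W. Then every v ∈ W equals the sum of its χ-components over all characters: v = ∑_{χ : G →* ℂˣ} v_χ, where v_χ := (↑(Nat.card G))⁻¹ • ∑_{g ∈ G} χ g • ρ g⁻¹ v. -/
/-- Orthogonality of characters: away from the identity, the values of all complex characters
of a finite commutative group sum to zero. -/
theorem sum_character_apply_of_ne_one {G : Type*} [CommGroup G] [Finite G]
    [Fintype (G →* ℂˣ)] {g : G} (hg : g ≠ 1) : ∑ χ : G →* ℂˣ, (χ g : ℂ) = 0 := by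
  have : NeZero (Monoid.exponent G) := ⟨Monoid.exponent_ne_zero_of_finite⟩
  obtain ⟨φ, hφ⟩ := CommGroup.exists_apply_ne_one_of_hasEnoughRootsOfUnity G ℂ hg
  refine eq_zero_of_mul_eq_self_left (b := (φ g : ℂ)) (by simpa using hφ) ?_
  rw [Finset.mul_sum]
  exact Fintype.sum_equiv (Equiv.mulLeft φ) _ _ fun χ => by simp

theorem sum_character_apply_one {G : Type*} [CommGroup G] [Finite G]
    [Fintype (G →* ℂˣ)] : ∑ χ : G →* ℂˣ, (χ 1 : ℂ) = Nat.card G := by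
  have : NeZero (Monoid.exponent G) := ⟨Monoid.exponent_ne_zero_of_finite⟩
  rw [← CommGroup.card_monoidHom_of_hasEnoughRootsOfUnity G ℂ]
  simp


/-- For a finite commutative group `G` acting `ℂ`-linearly on a complex vector
space `W`, every `v ∈ W` is the sum of its components
`v_χ = (|G|)⁻¹ • ∑_{g ∈ G} χ g • ρ g⁻¹ v` over all characters `χ : G →* ℂˣ`. -/
theorem eq_sum_components {G W : Type*} [CommGroup G] [Fintype G]
    [AddCommGroup W] [Module ℂ W] (ρ : G →* (W ≃ₗ[ℂ] W))
    [Fintype (G →* ℂˣ)] (v : W) :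
    v = ∑ χ : G →* ℂˣ,
      ((Nat.card G : ℂ))⁻¹ • ∑ g : G, (χ g : ℂ) • ρ g⁻¹ v := by
  have hcard : (Nat.card G : ℂ) ≠ 0 := Nat.cast_ne_zero.mpr Nat.card_pos.ne'
  rw [← Finset.smul_sum, Finset.sum_comm]
  simp_rw [← Finset.sum_smul]
  rw [Fintype.sum_eq_single 1 fun g hg => by rw [sum_character_apply_of_ne_one hg, zero_smul],
    sum_character_apply_one, inv_smul_smul₀ hcard]
  simp
end

section
/- Let G be a finite commutative group, let H = (G →* ℂˣ) be its character group (a commutative group under pointwise multiplication), and let φ : H →* Multiplicative (ZMod 2) be a surjective group homomorphism. Then the subgroup G₀ = {g ∈ G | χ g = 1 for every χ ∈ MonoidHom.ker φ} of G has exactly two elements: Nat.card G₀ = 2. -/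
/-- The subgroup of `G` consisting of elements annihilated by all characters in the
kernel of `φ`. -/
def jointKernel {G : Type*} [CommGroup G]
    (φ : (G →* ℂˣ) →* Multiplicative (ZMod 2)) : Subgroup G where
  carrier := {g : G | ∀ χ : G →* ℂˣ, χ ∈ MonoidHom.ker φ → χ g = 1}
  one_mem' := by intro χ _; simp
  mul_mem' := by
    intro a b ha hb χ hχ
    rw [map_mul, ha χ hχ, hb χ hχ, one_mul]
  inv_mem' := by
    intro a ha χ hχ
    rw [map_inv, ha χ hχ, inv_one]

/-- The annihilator in `G` of a subgroup `Φ` of the character group has cardinality the index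
of `Φ`. -/
theorem card_subgroupOrderIsoSubgroupMonoidHom_symm (G M : Type*) [CommGroup G] [Finite G]
    [CommMonoid M] [HasEnoughRootsOfUnity M (Monoid.exponent G)] (Φ : Subgroup (G →* Mˣ)) :
    Nat.card ((CommGroup.subgroupOrderIsoSubgroupMonoidHom G M).symm (OrderDual.toDual Φ)) =
      Φ.index := by
  set K := (CommGroup.subgroupOrderIsoSubgroupMonoidHom G M).symm (OrderDual.toDual Φ) with hK
  have hΦ : Nat.card Φ = Nat.card (G ⧸ K) := by
    rw [← CommGroup.card_subgroupOrderIsoSubgroupMonoidHom M K, hK, OrderIso.apply_symm_apply,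
      OrderDual.ofDual_toDual]
  have h := Φ.card_mul_index
  rw [CommGroup.card_monoidHom_of_hasEnoughRootsOfUnity,
    K.card_eq_card_quotient_mul_card_subgroup, hΦ] at h
  exact (Nat.eq_of_mul_eq_mul_left Nat.card_pos h).symm

/-- For a finite commutative group `G` with character group `H = G →* ℂˣ` and a
surjective homomorphism `φ : H →* Multiplicative (ZMod 2)`, the subgroup
`G₀ = {g ∈ G | χ g = 1 for all χ ∈ ker φ}` has exactly two elements. -/
theorem card_jointKernel_eq_two {G : Type*} [CommGroup G] [Finite G]
    (φ : (G →* ℂˣ) →* Multiplicative (ZMod 2))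
    (hφ : Function.Surjective φ) :
    Nat.card (jointKernel φ) = 2 := by
  have hG : NeZero (Monoid.exponent G) := ⟨Monoid.exponent_ne_zero_of_finite⟩
  have hK : jointKernel φ =
      (CommGroup.subgroupOrderIsoSubgroupMonoidHom G ℂ).symm (OrderDual.toDual φ.ker) := by
    ext g
    rw [CommGroup.mem_subgroupOrderIsoSubgroupMonoidHom_symm_iff]
    rfl
  rw [hK, card_subgroupOrderIsoSubgroupMonoidHom_symm, Subgroup.index_ker,
    MonoidHom.range_eq_top.mpr hφ, Subgroup.card_top]
  exact Nat.card_zmod 2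
end

section
/- Let E be a finite-dimensional real normed vector space, G a finite group acting linearly on E via ρ : G →* (E ≃L[ℝ] E), F : E → ℂ infinitely differentiable, x₀ ∈ E a point with ρ g x₀ = x₀ for all g ∈ G, and χ : G →* ℂˣ a character. Let F_χ : E → ℂ be defined by F_χ x = (↑(Nat.card G))⁻¹ * ∑_{g ∈ G} χ g * F (ρ g x). Then for every n ∈ ℕ and all v₁, …, vₙ ∈ E, iteratedFDeriv ℝ n F_χ x₀ (v₁, …, vₙ) = (↑(Nat.card G))⁻¹ * ∑_{g ∈ G} χ g * iteratedFDeriv ℝ n F x₀ (ρ g v₁, …, ρ g vₙ). In other words, the Taylor series of the χ-component F_χ of F equals the χ-component of the Taylor series of F. -/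
/-- **Proposition 2.9 (1).** The Taylor coefficients at a fixed point `x₀` of the
`χ`-component `F_χ x = (|G|)⁻¹ * ∑_{g ∈ G} χ g * F (ρ g x)` of a smooth function `F`
equal the `χ`-components of the Taylor coefficients of `F`. -/
theorem iteratedFDeriv_component {E G : Type*} [NormedAddCommGroup E]
    [NormedSpace ℝ E] [FiniteDimensional ℝ E] [Group G] [Fintype G]
    (ρ : G →* (E ≃L[ℝ] E)) (F : E → ℂ) (hF : ContDiff ℝ (⊤ : ℕ∞) F)
    (x₀ : E) (hx₀ : ∀ g : G, ρ g x₀ = x₀) (χ : G →* ℂˣ) :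
    ∀ (n : ℕ) (v : Fin n → E),
      iteratedFDeriv ℝ n
          (fun x => ((Nat.card G : ℂ))⁻¹ * ∑ g : G, (χ g : ℂ) * F (ρ g x)) x₀ v
        = ((Nat.card G : ℂ))⁻¹
            * ∑ g : G, (χ g : ℂ) * iteratedFDeriv ℝ n F x₀ (fun i => ρ g (v i)) := by
  intro n v
  have hcomp : ∀ g : G, ContDiff ℝ n fun x => F (ρ g x) := fun g =>
    (hF.of_le (by exact_mod_cast le_top)).comp (ρ g).contDiff
  have hmul : ∀ g : G, ContDiff ℝ n fun x => (χ g : ℂ) • F (ρ g x) := fun g =>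
    (hcomp g).const_smul _
  have hterm : ∀ g : G, iteratedFDeriv ℝ n (fun x => F (ρ g x)) x₀ v
      = iteratedFDeriv ℝ n F x₀ (fun i => ρ g (v i)) := fun g => by
    have h := (ρ g : E →L[ℝ] E).iteratedFDeriv_comp_right hF x₀
      (i := n) (by exact_mod_cast le_top)
    simp only [ContinuousLinearEquiv.coe_coe, hx₀] at h
    exact congrArg (fun L => L v) h
  simp only [← smul_eq_mul]
  rw [iteratedFDeriv_const_smul_apply' (ContDiff.sum fun g _ => hmul g).contDiffAt,
    iteratedFDeriv_fun_sum_apply fun g _ => (hmul g).contDiffAt]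
  simp only [smul_apply, sum_apply]
  refine congrArg _ (Finset.sum_congr rfl fun g _ => ?_)
  rw [iteratedFDeriv_const_smul_apply' (hcomp g).contDiffAt,
    smul_apply, hterm]
end

section
/- Let E be a finite-dimensional real normed vector space, G a finite group acting linearly on E via ρ : G →* (E ≃L[ℝ] E), F : E → ℂ infinitely differentiable, x₀ ∈ E a point with ρ g x₀ = x₀ for all g ∈ G, and χ : G →* ℂˣ a character. Let F_χ : E → ℂ be defined by F_χ x = (↑(Nat.card G))⁻¹ * ∑_{g ∈ G} χ g * F (ρ g x). Then the Taylor coefficients of F_χ at x₀ are χ-equivariant: for every h ∈ G, every n ∈ ℕ, and all v₁, …, vₙ ∈ E, iteratedFDeriv ℝ n F_χ x₀ (ρ h v₁, …, ρ h vₙ) = (χ h)⁻¹ * iteratedFDeriv ℝ n F_χ x₀ (v₁, …, vₙ); equivalently, the action of h on the Taylor series of F_χ multiplies it by χ h. -/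
/-- Precomposing the `χ`-weighted group sum of `F` with `ρ h` multiplies it by `(χ h)⁻¹`. -/
theorem sum_character_mul_comp {E G : Type*} [NormedAddCommGroup E] [NormedSpace ℝ E]
    [Group G] [Fintype G] (ρ : G →* (E ≃L[ℝ] E)) (F : E → ℂ) (χ : G →* ℂˣ) (h : G) (x : E) :
    ∑ g : G, (χ g : ℂ) * F (ρ g (ρ h x)) = (χ h : ℂ)⁻¹ * ∑ g : G, (χ g : ℂ) * F (ρ g x) := by
  rw [← Equiv.sum_comp (Equiv.mulRight h) (fun g => (χ g : ℂ) * F (ρ g x)), Finset.mul_sum]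
  refine Finset.sum_congr rfl fun g _ => ?_
  have hh : (χ h : ℂ) ≠ 0 := (χ h).ne_zero
  simp only [Equiv.coe_mulRight, map_mul, Units.val_mul]
  field_simp
  rfl

/-- If `f ∘ L = c • f` for a continuous linear equivalence `L` fixing `x`, then the derivatives
of `f` at `x` satisfy the same relation. -/
theorem iteratedFDeriv_apply_of_comp_eq_mul {E : Type*} [NormedAddCommGroup E] [NormedSpace ℝ E]
    (L : E ≃L[ℝ] E) {f : E → ℂ} (hf : ContDiff ℝ (⊤ : ℕ∞) f) {x : E} (hx : L x = x) {c : ℂ}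
    (hc : ∀ y, f (L y) = c * f y) (n : ℕ) (v : Fin n → E) :
    iteratedFDeriv ℝ n f x (fun i => L (v i)) = c * iteratedFDeriv ℝ n f x v := by
  have hn : (n : WithTop ℕ∞) ≤ (⊤ : ℕ∞) := by exact_mod_cast le_top
  have key : f ∘ (L : E →L[ℝ] E) = c • f := funext hc
  have hright := (L : E →L[ℝ] E).iteratedFDeriv_comp_right hf x hn
  rw [key, iteratedFDeriv_const_smul_apply (hf.contDiffAt.of_le hn)] at hright
  simpa [hx] using congrArg (fun m => m v) hright.symm

/-- **Proposition 2.9 (2).** The Taylor coefficients at a fixed point `x₀` of the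
`χ`-component `F_χ x = (|G|)⁻¹ * ∑_{g ∈ G} χ g * F (ρ g x)` of a smooth function `F`
are `χ`-equivariant: letting `ρ h` act on the arguments multiplies them by `(χ h)⁻¹`. -/
theorem iteratedFDeriv_component_equivariant {E G : Type*} [NormedAddCommGroup E]
    [NormedSpace ℝ E] [FiniteDimensional ℝ E] [Group G] [Fintype G]
    (ρ : G →* (E ≃L[ℝ] E)) (F : E → ℂ) (hF : ContDiff ℝ (⊤ : ℕ∞) F)
    (x₀ : E) (hx₀ : ∀ g : G, ρ g x₀ = x₀) (χ : G →* ℂˣ) :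
    ∀ (h : G) (n : ℕ) (v : Fin n → E),
      iteratedFDeriv ℝ n
          (fun x => ((Nat.card G : ℂ))⁻¹ * ∑ g : G, (χ g : ℂ) * F (ρ g x)) x₀
          (fun i => ρ h (v i))
        = ((χ h : ℂ))⁻¹
            * iteratedFDeriv ℝ n
                (fun x => ((Nat.card G : ℂ))⁻¹ * ∑ g : G, (χ g : ℂ) * F (ρ g x)) x₀ v := by
  intro h n v
  refine iteratedFDeriv_apply_of_comp_eq_mul (ρ h) ?_ (hx₀ h) (fun y => ?_) n v
  · exact contDiff_const.mul (ContDiff.sum fun g _ =>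
      contDiff_const.mul (hF.comp (ρ g).contDiff))
  · rw [sum_character_mul_comp ρ F χ h y, mul_left_comm]
end

section
/- Let E be a complex normed vector space, G a finite commutative group acting ℂ-linearly on E via ρ : G →* (E ≃L[ℂ] E), F : E → ℂ holomorphic (ContDiff ℂ ⊤), x₀ ∈ E a point with ρ g x₀ = x₀ for all g ∈ G, and χ : G →* ℂˣ a character. Let F_χ : E → ℂ be defined by F_χ x = (↑(Nat.card G))⁻¹ * ∑_{g ∈ G} χ g * F (ρ g x). Suppose v₁, …, vₙ ∈ E are homogeneous vectors of weights χ₁, …, χₙ (i.e. ρ g vᵢ = χᵢ g • vᵢ for all g ∈ G and each i), and suppose χ * χ₁ * ⋯ * χₙ ≠ 1 in the character group. Then iteratedFDeriv ℂ n F_χ x₀ (v₁, …, vₙ) = 0. In other words, every monomial appearing in the Taylor series of F_χ has weight χ. -/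
/-- The `n`-th Taylor coefficient of `f ∘ L` at a fixed point `x` of the linear map `L`, evaluated
on eigenvectors of `L`, is that of `f` scaled by the product of the eigenvalues. -/
theorem ContDiff.iteratedFDeriv_comp_right_apply_of_eigenvectors {𝕜 E F : Type*}
    [NontriviallyNormedField 𝕜] [NormedAddCommGroup E] [NormedSpace 𝕜 E]
    [NormedAddCommGroup F] [NormedSpace 𝕜 F] {n : ℕ} {f : E → F} (hf : ContDiff 𝕜 n f)
    (L : E →L[𝕜] E) {x : E} (hx : L x = x) {v : Fin n → E} {c : Fin n → 𝕜}
    (hv : ∀ i, L (v i) = c i • v i) :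
    iteratedFDeriv 𝕜 n (fun y => f (L y)) x v = (∏ i, c i) • iteratedFDeriv 𝕜 n f x v := by
  have h := L.iteratedFDeriv_comp_right hf x le_rfl
  rw [hx] at h
  simp only [Function.comp_def] at h
  rw [h, ContinuousMultilinearMap.compContinuousLinearMap_apply]
  simp only [hv, ContinuousMultilinearMap.map_smul_univ]

/-- **Proposition 2.9 (3), holomorphic setting.** If `v₁, …, vₙ` are homogeneous
vectors of weights `χ₁, …, χₙ` and `χ * χ₁ * ⋯ * χₙ ≠ 1`, then the `n`-th Taylor
coefficient at a fixed point `x₀` of the `χ`-component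
`F_χ x = (|G|)⁻¹ * ∑_{g ∈ G} χ g * F (ρ g x)` of a holomorphic `F` vanishes on
`(v₁, …, vₙ)`: every monomial of the Taylor series of `F_χ` has weight `χ`. -/
theorem iteratedFDeriv_component_eq_zero {E G : Type*} [NormedAddCommGroup E]
    [NormedSpace ℂ E] [CommGroup G] [Fintype G]
    (ρ : G →* (E ≃L[ℂ] E)) (F : E → ℂ) (hF : ContDiff ℂ ⊤ F)
    (x₀ : E) (hx₀ : ∀ g : G, ρ g x₀ = x₀) (χ : G →* ℂˣ)
    (n : ℕ) (v : Fin n → E) (χs : Fin n → (G →* ℂˣ))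
    (hv : ∀ (i : Fin n) (g : G), ρ g (v i) = (χs i g : ℂ) • v i)
    (hne : χ * ∏ i : Fin n, χs i ≠ 1) :
    iteratedFDeriv ℂ n
        (fun x => ((Nat.card G : ℂ))⁻¹ * ∑ g : G, (χ g : ℂ) * F (ρ g x)) x₀ v = 0 := by
  have hF' : ContDiff ℂ n F := hF.of_le le_top
  have hcomp (g : G) : ContDiff ℂ n fun x => F (ρ g x) := hF'.comp (ρ g).contDiff
  have hterm (g : G) : ContDiff ℂ n fun x => (χ g : ℂ) • F (ρ g x) :=
    (hcomp g).const_smul _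
  have hsum : ContDiff ℂ n fun x => ∑ g : G, (χ g : ℂ) • F (ρ g x) :=
    ContDiff.sum fun g _ => hterm g
  have hcoeff (g : G) : iteratedFDeriv ℂ n (fun x => (χ g : ℂ) • F (ρ g x)) x₀ v =
      ((χ * ∏ i, χs i) g : ℂ) * iteratedFDeriv ℂ n F x₀ v := by
    have h := hF'.iteratedFDeriv_comp_right_apply_of_eigenvectors (ρ g : E →L[ℂ] E) (hx₀ g)
      (fun i => hv i g)
    simp only [ContinuousLinearEquiv.coe_coe] at h
    rw [iteratedFDeriv_const_smul_apply' (hcomp g).contDiffAt, smul_apply, h]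
    simp [MonoidHom.finsetProd_apply, mul_assoc]
  have hchar : ∑ g : G, ((χ * ∏ i, χs i) g : ℂ) = 0 := by
    refine sum_hom_units_eq_zero ((Units.coeHom ℂ).comp (χ * ∏ i, χs i)) fun h => hne ?_
    ext g
    exact DFunLike.congr_fun h g
  simp only [← smul_eq_mul (a := (_ : ℂ))]
  rw [iteratedFDeriv_const_smul_apply' hsum.contDiffAt, smul_apply,
    iteratedFDeriv_fun_sum_apply fun g _ => (hterm g).contDiffAt,
    sum_apply]
  simp only [hcoeff]
  rw [← Finset.sum_mul, hchar, zero_mul, smul_zero]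
end

section
/- Let E be a finite-dimensional real normed vector space and A ⊆ E an arbitrary subset. Let (Wᵢ)_{i ∈ ι} be a family of open subsets of E with A ⊆ ⋃ᵢ Wᵢ, and let fᵢ : E → ℂ be functions such that each fᵢ is infinitely differentiable on Wᵢ (ContDiffOn ℝ ⊤ fᵢ Wᵢ). Assume germ compatibility along A: for every x ∈ A and all indices i, j with x ∈ Wᵢ and x ∈ Wⱼ, the functions fᵢ and fⱼ agree on some neighborhood of x (fᵢ =ᶠ[𝓝 x] fⱼ). Then there exist an open set W ⊆ E with A ⊆ W and a function f : E → ℂ such that f is infinitely differentiable on W (ContDiffOn ℝ ⊤ f W) and, for every x ∈ A and every index i with x ∈ Wᵢ, f agrees with fᵢ on some neighborhood of x (f =ᶠ[𝓝 x] fᵢ). -/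
open Filter Topology

/-- A selection of indices for an open cover of a paracompact Hausdorff space can be made such
that, near each point `x`, only finitely many indices are selected, all of whose sets contain `x`. -/
theorem exists_locally_finite_selection {X ι : Type*} [TopologicalSpace X] [ParacompactSpace X]
    [T2Space X] (U : ι → Set X) (hU : ∀ i, IsOpen (U i)) (hcover : ⋃ i, U i = Set.univ) :
    ∃ c : X → ι, ∀ x, ∃ s : Set ι, s.Finite ∧ (∀ i ∈ s, x ∈ U i) ∧ ∀ᶠ y in 𝓝 x, c y ∈ s := by
  obtain ⟨V, hVo, hVcover, hVfin, hVU⟩ := precise_refinement U hU hcover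
  obtain ⟨C, hCcover, hCc, hCV⟩ :=
    exists_iUnion_eq_closed_subset hVo hVfin.point_finite hVcover
  have hmem : ∀ x, ∃ i, x ∈ C i := fun x => by
    simpa using hCcover.symm.subset (Set.mem_univ x)
  choose c hc using hmem
  have hCfin : LocallyFinite C := hVfin.subset hCV
  refine ⟨c, fun x => ⟨{i | x ∈ C i}, hCfin.point_finite x,
    fun i hi => hVU i (hCV i hi), ?_⟩⟩
  filter_upwards [hCfin.eventually_subset hCc x] with y hy
  exact hy (hc y)

/-- **Proposition 3.8 (surjectivity).** Given a set `A` in a finite-dimensional real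
normed space, an open cover `(Wᵢ)` of `A`, and smooth functions `fᵢ` on `Wᵢ` whose
germs agree along `A`, there is a single open neighborhood `W` of `A` and a function
`f` smooth on `W` whose germ at every point of `A` agrees with the given data. -/
theorem glue_smooth_germs {E : Type*} [NormedAddCommGroup E] [NormedSpace ℝ E]
    [FiniteDimensional ℝ E] (A : Set E) {ι : Type*} (W : ι → Set E)
    (hW : ∀ i, IsOpen (W i)) (hcover : A ⊆ ⋃ i, W i)
    (f : ι → E → ℂ) (hf : ∀ i, ContDiffOn ℝ (⊤ : ℕ∞) (f i) (W i))
    (hcompat : ∀ x ∈ A, ∀ i j, x ∈ W i → x ∈ W j → f i =ᶠ[𝓝 x] f j) :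
    ∃ (W₀ : Set E) (f₀ : E → ℂ), IsOpen W₀ ∧ A ⊆ W₀ ∧
      ContDiffOn ℝ (⊤ : ℕ∞) f₀ W₀ ∧
      ∀ x ∈ A, ∀ i, x ∈ W i → f₀ =ᶠ[𝓝 x] f i := by
  have hopen : IsOpen (⋃ i, W i) := isOpen_iUnion hW
  obtain ⟨c, hc⟩ := exists_locally_finite_selection
    (fun i => ((↑) : (⋃ i, W i : Set E) → E) ⁻¹' W i)
    (fun i => (hW i).preimage continuous_subtype_val)
    (by rw [← Set.preimage_iUnion, Subtype.coe_preimage_self])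
  classical
  let f₀ : E → ℂ := fun y => if hy : y ∈ ⋃ i, W i then f (c ⟨y, hy⟩) y else 0
  have hgerm : ∀ x ∈ A, ∀ i, x ∈ W i → f₀ =ᶠ[𝓝 x] f i := by
    intro x hx i hi
    obtain ⟨s, hs, hsW, hcs⟩ := hc ⟨x, hcover hx⟩
    have hagree : ∀ᶠ y in 𝓝 x, ∀ j ∈ s, f j y = f i y :=
      hs.eventually_all.2 fun j hj => hcompat x hx j i (hsW j hj) hi
    change ∀ᶠ y in 𝓝 x, f₀ y = f i y
    rw [← hopen.isOpenEmbedding_subtypeVal.map_nhds_eq ⟨x, hcover hx⟩, eventually_map]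
    filter_upwards [hcs, continuous_subtype_val.continuousAt.eventually hagree] with y hy hyf
    simpa only [f₀, dif_pos y.2] using hyf _ hy
  refine ⟨{x | ∃ i, x ∈ W i ∧ f₀ =ᶠ[𝓝 x] f i}, f₀, ?_, ?_, ?_, hgerm⟩
  · refine isOpen_iff_mem_nhds.2 ?_
    rintro x ⟨i, hi, hfi⟩
    filter_upwards [(hW i).mem_nhds hi, hfi.eventuallyEq_nhds] with y hy hyf
    exact ⟨i, hy, hyf⟩
  · intro x hx
    obtain ⟨i, hi⟩ := Set.mem_iUnion.1 (hcover hx)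
    exact ⟨i, hi, hgerm x hx i hi⟩
  · rintro x ⟨i, hi, hfi⟩
    exact (((hf i).contDiffAt ((hW i).mem_nhds hi)).congr_of_eventuallyEq hfi).contDiffWithinAt
end
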